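/- For all integers n ≥ 1 and k ≥ 1, the real n×n matrix indexed by a, b ∈ ℤ/n with entries Re(i^{-k} · Li_{k+1}(ζ_n^{ab})) has rank ⌊(n+2)/2⌋ if k is even and rank ⌊(n−1)/2⌋ if k is odd. -/

import Mathlib

/-- The polylogarithm series: `Li k z = ∑_{m=1}^∞ z^m / m^k`. -/
noncomputable def Li (k : ℕ) (z : ℂ) : ℂ := ∑' m : ℕ, z ^ (m + 1) / ((m : ℂ) + 1) ^ k

/-- The standard primitive `n`-th root of unity `ζ_n = exp(2πi/n)`. -/
noncomputable def zetaN (n : ℕ) : ℂ := Complex.exp (2 * Real.pi * Complex.I / n)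

open scoped Matrix
open Finset

/-- An idempotent real matrix has rank equal to its trace. -/
lemma rank_eq_trace_of_isIdempotentElem {ι : Type*} [Fintype ι] [DecidableEq ι]
    {Q : Matrix ι ι ℝ} (hQ : IsIdempotentElem Q) : (Q.rank : ℝ) = Q.trace := by
  have hproj : LinearMap.IsProj (LinearMap.range (Matrix.toLin' Q)) (Matrix.toLin' Q) := by
    refine ⟨fun x => LinearMap.mem_range_self _ x, ?_⟩
    rintro _ ⟨y, rfl⟩
    rw [Matrix.toLin'_apply, Matrix.toLin'_apply, Matrix.mulVec_mulVec, hQ.eq]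
  have h := hproj.trace
  rw [Matrix.trace_toLin'_eq] at h
  rw [h]
  rfl

/-- Two matrices with the same null space have the same rank. -/
lemma rank_eq_of_mulVec_eq_zero_iff {ι : Type*} [Fintype ι] [DecidableEq ι]
    {A B : Matrix ι ι ℝ} (h : ∀ x, A *ᵥ x = 0 ↔ B *ᵥ x = 0) : A.rank = B.rank := by
  have hker : LinearMap.ker A.mulVecLin = LinearMap.ker B.mulVecLin := by
    ext x
    simpa using h x
  have hA := A.mulVecLin.finrank_range_add_finrank_ker
  have hB := B.mulVecLin.finrank_range_add_finrank_ker
  rw [hker] at hA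
  unfold Matrix.rank
  omega

lemma summable_one_div_succ_pow {s : ℕ} (hs : 2 ≤ s) :
    Summable fun m : ℕ => 1 / ((m : ℝ) + 1) ^ s := by
  have h := (summable_nat_add_iff 1).mpr (Real.summable_one_div_nat_pow.mpr hs)
  simpa using h

lemma summable_div_succ_pow {s : ℕ} (hs : 2 ≤ s) {f : ℕ → ℝ} {C : ℝ} (hf : ∀ m, |f m| ≤ C) :
    Summable fun m : ℕ => f m / ((m : ℝ) + 1) ^ s := by
  refine Summable.of_norm_bounded ((summable_one_div_succ_pow hs).mul_left C) fun m => ?_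
  rw [Real.norm_eq_abs, abs_div, abs_of_pos (a := ((m : ℝ) + 1) ^ s) (by positivity),
    mul_one_div]
  gcongr
  exact hf m

lemma tsum_one_div_add_two_pow_lt_one {s : ℕ} (hs : 2 ≤ s) :
    ∑' m : ℕ, 1 / ((m : ℝ) + 1 + 1) ^ s < 1 := by
  have hsum (t : ℕ) (ht : 2 ≤ t) : Summable fun m : ℕ => 1 / ((m : ℝ) + 1 + 1) ^ t := by
    simpa using (summable_nat_add_iff 1).mpr (summable_one_div_succ_pow ht)
  have htwo : ∑' m : ℕ, 1 / ((m : ℝ) + 1 + 1) ^ 2 = Real.pi ^ 2 / 6 - 1 := by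
    have h := hasSum_zeta_two.summable.sum_add_tsum_nat_add 2
    rw [hasSum_zeta_two.tsum_eq] at h
    simp only [sum_range_succ, sum_range_zero] at h
    have hcongr : ∑' m : ℕ, 1 / ((m : ℝ) + 1 + 1) ^ 2
        = ∑' m : ℕ, 1 / (((m + 2 : ℕ) : ℝ)) ^ 2 := by
      congr 1; ext m; push_cast; ring
    rw [hcongr]
    norm_num at h ⊢
    linarith
  have hle : ∑' m : ℕ, 1 / ((m : ℝ) + 1 + 1) ^ s ≤ ∑' m : ℕ, 1 / ((m : ℝ) + 1 + 1) ^ 2 := by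
    refine (hsum s hs).tsum_le_tsum (fun m => ?_) (hsum 2 le_rfl)
    have : (1 : ℝ) ≤ (m : ℝ) + 1 + 1 := by linarith [Nat.cast_nonneg (α := ℝ) m]
    gcongr
  nlinarith [Real.pi_lt_d2, Real.pi_pos]

/-- The operator `F ↦ (a ↦ ∑ F (m a) / m ^ s)` on functions on `ℤ/n` is
injective, because `∑_{m ≥ 2} 1 / m ^ s < 1`. -/
lemma eq_zero_of_tsum_dilate_eq_zero {n s : ℕ} [NeZero n] (hs : 2 ≤ s) {F : ZMod n → ℝ}
    (h : ∀ a, ∑' m : ℕ, F ((m + 1 : ℕ) * a) / ((m : ℝ) + 1) ^ s = 0) : F = 0 := by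
  obtain ⟨a, ha⟩ := Finite.exists_max fun a => |F a|
  have hsum := summable_div_succ_pow hs (f := fun m => F ((m + 1 : ℕ) * a)) fun m => ha _
  have hsplit := hsum.tsum_eq_zero_add
  rw [h a] at hsplit
  have hbound : |∑' m : ℕ, F ((m + 1 + 1 : ℕ) * a) / (((m + 1 : ℕ) : ℝ) + 1) ^ s|
      ≤ |F a| * ∑' m : ℕ, 1 / ((m : ℝ) + 1 + 1) ^ s := by
    rw [← tsum_mul_left, ← Real.norm_eq_abs]
    refine tsum_of_norm_bounded (Summable.hasSum ?_) fun m => ?_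
    · refine Summable.mul_left _ ?_
      simpa using (summable_nat_add_iff 1).mpr (summable_one_div_succ_pow hs)
    · push_cast
      rw [Real.norm_eq_abs, abs_div, abs_of_pos (a := ((m : ℝ) + 1 + 1) ^ s) (by positivity),
        mul_one_div]
      exact div_le_div_of_nonneg_right (ha _) (by positivity)
  have hFa : F a = -∑' m : ℕ, F ((m + 1 + 1 : ℕ) * a) / (((m + 1 : ℕ) : ℝ) + 1) ^ s := by
    simp only [zero_add, Nat.cast_one, one_mul, Nat.cast_zero, one_pow, div_one] at hsplit
    linarith
  rw [← abs_neg, ← hFa] at hbound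
  have hlt := tsum_one_div_add_two_pow_lt_one hs
  have hzero : |F a| = 0 := by nlinarith [abs_nonneg (F a)]
  ext b
  exact abs_eq_zero.mp (le_antisymm (hzero ▸ ha b) (abs_nonneg _))

lemma zetaN_pow_val {n : ℕ} [NeZero n] (c : ZMod n) : zetaN n ^ c.val = ZMod.stdAddChar c := by
  have h := ZMod.stdAddChar_coe (N := n) c.val
  rw [Int.cast_natCast, ZMod.natCast_zmod_val] at h
  rw [h, zetaN, ← Complex.exp_nat_mul]
  congr 1
  push_cast
  ring

/-- The real trigonometric function `Re (i⁻ᵏ e(a / n))` on `ℤ/n`. -/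
noncomputable def trigKernel (n k : ℕ) [NeZero n] (a : ZMod n) : ℝ :=
  (Complex.I ^ (-(k : ℤ)) * ZMod.stdAddChar a).re

lemma norm_I_zpow_mul_stdAddChar {n : ℕ} [NeZero n] (j : ℤ) (a : ZMod n) :
    ‖Complex.I ^ j * ZMod.stdAddChar a‖ = 1 := by
  rw [norm_mul, norm_zpow, Complex.norm_I, one_zpow, one_mul, ZMod.stdAddChar_apply,
    Circle.norm_coe]

lemma abs_trigKernel_le_one (n k : ℕ) [NeZero n] (a : ZMod n) : |trigKernel n k a| ≤ 1 :=
  (Complex.abs_re_le_norm _).trans (norm_I_zpow_mul_stdAddChar _ a).le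

lemma re_I_zpow_mul_Li (n k : ℕ) [NeZero n] (hk : 1 ≤ k) (c : ZMod n) :
    (Complex.I ^ (-(k : ℤ)) * Li (k + 1) (zetaN n ^ c.val)).re
      = ∑' m : ℕ, trigKernel n k ((m + 1 : ℕ) * c) / ((m : ℝ) + 1) ^ (k + 1) := by
  have hterm (m : ℕ) :
      Complex.I ^ (-(k : ℤ)) * ((zetaN n ^ c.val) ^ (m + 1) / ((m : ℂ) + 1) ^ (k + 1))
        = Complex.I ^ (-(k : ℤ)) * ZMod.stdAddChar (((m + 1 : ℕ) : ZMod n) * c)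
            / (((m : ℝ) + 1) ^ (k + 1) : ℝ) := by
    rw [zetaN_pow_val, ← AddChar.map_nsmul_eq_pow, nsmul_eq_mul]
    push_cast
    ring
  rw [Li, ← tsum_mul_left, Complex.re_tsum]
  · refine tsum_congr fun m => ?_
    rw [hterm, Complex.div_ofReal_re, trigKernel]
  · refine Summable.of_norm_bounded (summable_one_div_succ_pow (s := k + 1) (by omega))
      fun m => ?_
    rw [hterm, norm_div, norm_I_zpow_mul_stdAddChar, Complex.norm_real, Real.norm_eq_abs,
      abs_of_pos (by positivity)]

lemma ofReal_trigKernel (n k : ℕ) [NeZero n] (a : ZMod n) :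
    (trigKernel n k a : ℂ) = Complex.I ^ (-(k : ℤ)) *
      ((ZMod.stdAddChar a + (-1) ^ k * ZMod.stdAddChar (-a)) / 2) := by
  have hI : (starRingEnd ℂ) (Complex.I ^ (-(k : ℤ))) = (-1) ^ k * Complex.I ^ (-(k : ℤ)) := by
    rw [map_zpow₀, Complex.conj_I, zpow_neg, zpow_neg, zpow_natCast, zpow_natCast, neg_pow,
      mul_inv, ← inv_pow, inv_neg_one]
  rw [trigKernel, Complex.re_eq_add_conj, map_mul, hI, AddChar.map_neg_eq_conj]
  ring

/-- The projection of functions on `ℤ/n` onto those of parity `(-1) ^ k`. -/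
noncomputable def parityProj (n k : ℕ) : Matrix (ZMod n) (ZMod n) ℝ :=
  (1 / 2 : ℝ) • (1 + (-1 : ℝ) ^ k • (Equiv.neg (ZMod n)).permMatrix ℝ)

lemma parityProj_mulVec (n k : ℕ) [NeZero n] (x : ZMod n → ℝ) (b : ZMod n) :
    (parityProj n k *ᵥ x) b = (x b + (-1) ^ k * x (-b)) / 2 := by
  simp [parityProj, Matrix.smul_mulVec, Matrix.add_mulVec, Matrix.permMatrix_mulVec]
  ring

lemma isIdempotentElem_parityProj (n k : ℕ) [NeZero n] : IsIdempotentElem (parityProj n k) := by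
  refine Matrix.toLin'.injective (LinearMap.ext fun x => funext fun b => ?_)
  have hsq : ((-1 : ℝ) ^ k) * (-1) ^ k = 1 := by rw [← mul_pow]; simp
  rw [Matrix.toLin'_apply, Matrix.toLin'_apply, ← Matrix.mulVec_mulVec]
  simp only [parityProj_mulVec, neg_neg]
  linear_combination x b / 4 * hsq

lemma sum_trigKernel_mul (n k : ℕ) [NeZero n] (x : ZMod n → ℝ) (a : ZMod n) :
    ((∑ b, trigKernel n k (a * b) * x b : ℝ) : ℂ) = Complex.I ^ (-(k : ℤ)) *
      ZMod.dft (fun b => (((parityProj n k *ᵥ x) b : ℝ) : ℂ)) (-a) := by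
  have hneg : ∑ b, ZMod.stdAddChar (-(a * b)) * (x b : ℂ)
      = ∑ b, ZMod.stdAddChar (a * b) * (x (-b) : ℂ) := by
    rw [← Equiv.sum_comp (Equiv.neg (ZMod n))]
    simp
  have hleft : ((∑ b, trigKernel n k (a * b) * x b : ℝ) : ℂ) = Complex.I ^ (-(k : ℤ)) *
      ((∑ b, ZMod.stdAddChar (a * b) * (x b : ℂ)
        + (-1) ^ k * ∑ b, ZMod.stdAddChar (-(a * b)) * (x b : ℂ)) / 2) := by
    push_cast
    simp only [ofReal_trigKernel, mul_sum, ← sum_add_distrib, sum_div]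
    exact sum_congr rfl fun b _ => by ring
  rw [hleft, hneg, ZMod.dft_apply]
  simp only [parityProj_mulVec, mul_sum, ← sum_add_distrib, sum_div, smul_eq_mul]
  refine sum_congr rfl fun b _ => ?_
  rw [mul_neg, neg_neg, mul_comm b a]
  push_cast
  ring

lemma sum_trigKernel_mul_eq_zero_iff (n k : ℕ) [NeZero n] (x : ZMod n → ℝ) :
    (∀ a, ∑ b, trigKernel n k (a * b) * x b = 0) ↔ parityProj n k *ᵥ x = 0 := by
  have hI : Complex.I ^ (-(k : ℤ)) ≠ 0 := zpow_ne_zero _ Complex.I_ne_zero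
  constructor
  · intro h
    have hdft : ZMod.dft (fun b => (((parityProj n k *ᵥ x) b : ℝ) : ℂ)) = 0 := by
      ext a
      have ha := sum_trigKernel_mul n k x (-a)
      rw [h, neg_neg, Complex.ofReal_zero, eq_comm, mul_eq_zero] at ha
      exact ha.resolve_left hI
    rw [LinearEquiv.map_eq_zero_iff] at hdft
    ext b
    exact Complex.ofReal_eq_zero.mp (congrFun hdft b)
  · intro h a
    have ha := sum_trigKernel_mul n k x a
    rw [h, ZMod.dft_apply] at ha
    rw [← Complex.ofReal_eq_zero, ha]
    simp

/-- Negation on `ℤ/n` has one fixed point for odd `n` and two for even `n`. -/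
lemma ncard_fixedPoints_neg (n : ℕ) [NeZero n] :
    (Function.fixedPoints (Equiv.neg (ZMod n))).ncard = if Even n then 2 else 1 := by
  have hn : 0 < n := NeZero.pos n
  split_ifs with h
  · obtain ⟨m, hm⟩ := h
    have hval : ((m : ℕ) : ZMod n).val = m := ZMod.val_natCast_of_lt (by omega)
    have hset : Function.fixedPoints (Equiv.neg (ZMod n)) = {0, (m : ZMod n)} := by
      ext a
      simp only [Function.mem_fixedPoints, Function.IsFixedPt, Equiv.neg_apply,
        ZMod.neg_eq_self_iff, Set.mem_insert_iff, Set.mem_singleton_iff]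
      refine or_congr_right ⟨fun ha => ZMod.val_injective n ?_, fun ha => ?_⟩
      · omega
      · rw [ha]; omega
    rw [hset, Set.ncard_pair]
    intro h0
    rw [← h0, ZMod.val_zero] at hval
    omega
  · have hset : Function.fixedPoints (Equiv.neg (ZMod n)) = {0} := by
      ext a
      simp only [Function.mem_fixedPoints, Function.IsFixedPt, Equiv.neg_apply,
        ZMod.neg_eq_self_iff, Set.mem_singleton_iff]
      refine or_iff_left fun ha => h ⟨a.val, by omega⟩
    rw [hset, Set.ncard_singleton]

lemma rank_parityProj (n k : ℕ) [NeZero n] :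
    (parityProj n k).rank = if Even k then (n + 2) / 2 else (n - 1) / 2 := by
  have hn : 0 < n := NeZero.pos n
  have htrace := rank_eq_trace_of_isIdempotentElem (isIdempotentElem_parityProj n k)
  rw [parityProj, Matrix.trace_smul, Matrix.trace_add, Matrix.trace_one, Matrix.trace_smul,
    Matrix.trace_permutation, ncard_fixedPoints_neg, ZMod.card, ← parityProj] at htrace
  have hdouble : 2 * ((parityProj n k).rank : ℝ)
      = n + (-1) ^ k * ((if Even n then 2 else 1 : ℕ) : ℝ) := by
    rw [htrace]; simp only [smul_eq_mul]; ring
  split_ifs with hk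
  · rw [hk.neg_one_pow, one_mul] at hdouble
    norm_cast at hdouble
    split_ifs at hdouble with h
    · omega
    · rw [Nat.not_even_iff] at h; omega
  · rw [(Nat.not_even_iff_odd.mp hk).neg_one_pow, neg_one_mul, ← sub_eq_add_neg,
      eq_sub_iff_add_eq] at hdouble
    norm_cast at hdouble
    split_ifs at hdouble with h
    · omega
    · rw [Nat.not_even_iff] at h; omega

/-- For `n ≥ 1` and `k ≥ 1`, the real `n × n` matrix indexed by `a, b ∈ ℤ/n` with
entries `Re(i^{-k} · Li_{k+1}(ζ_n^{ab}))` has rank `⌊(n+2)/2⌋` if `k` is even and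
rank `⌊(n−1)/2⌋` if `k` is odd. -/
theorem stmt15 (n k : ℕ) [NeZero n] (hk : 1 ≤ k) :
    (Matrix.of (fun a b : ZMod n =>
        (Complex.I ^ (-(k : ℤ)) * Li (k + 1) (zetaN n ^ ((a * b : ZMod n).val))).re)).rank =
      if Even k then (n + 2) / 2 else (n - 1) / 2 := by
  rw [← rank_parityProj n k]
  refine rank_eq_of_mulVec_eq_zero_iff fun x => ?_
  rw [← sum_trigKernel_mul_eq_zero_iff]
  set F : ZMod n → ℝ := fun a => ∑ b, trigKernel n k (a * b) * x b with hF
  have hmulVec (a : ZMod n) : (Matrix.of (fun a b : ZMod n =>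
      (Complex.I ^ (-(k : ℤ)) * Li (k + 1) (zetaN n ^ ((a * b : ZMod n).val))).re) *ᵥ x) a
        = ∑' m : ℕ, F ((m + 1 : ℕ) * a) / ((m : ℝ) + 1) ^ (k + 1) := by
    simp only [Matrix.mulVec, dotProduct, Matrix.of_apply, re_I_zpow_mul_Li n k hk, hF, sum_div,
      ← tsum_mul_right]
    rw [← Summable.tsum_finsetSum]
    · refine tsum_congr fun m => sum_congr rfl fun b _ => ?_
      rw [mul_assoc]
      ring
    · intro b _
      exact (summable_div_succ_pow (by omega) fun m => abs_trigKernel_le_one n k _).mul_right _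
  constructor
  · intro h
    refine congrFun (eq_zero_of_tsum_dilate_eq_zero (s := k + 1) (by omega) fun a => ?_)
    rw [← hmulVec, h, Pi.zero_apply]
  · intro h
    ext a
    rw [hmulVec]
    simp [show ∀ a, F a = 0 from h]
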